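/- Let w ∈ S_n and let I ⊆ J(w). Write D = [n−1] ∖ I = {d_1 < d_2 < … < d_k}, d_0 = 0, d_{k+1} = n. Then the following are equivalent: (a) w_0(I)·w is a standard Coxeter element of some parabolic subgroup of S_n; (b) there exists a reduced word w = s_{i_1}s_{i_2}⋯s_{i_{ℓ(w)}} such that (S.1) for each d ∈ D the letter s_d appears at most once, and (S.2) for each 1 ≤ t ≤ k+1, #{m : d_{t−1} < i_m < d_t} < binom(d_t − d_{t−1} + 1, 2). -/

import Mathlib

open scoped Classical

namespace LSS

noncomputable section

open MvPolynomial

/-- The simple transposition `s_i ∈ S_n` (`1 ≤ i ≤ n-1`, 1-indexed): it exchanges the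
letters `i` and `i+1` of `[n] = {1, …, n}`, realized on `Fin n` (0-indexed) as the swap
of `i-1` and `i`. For `i` out of range it is the identity. -/
def st (n : ℕ) (i : ℕ) : Equiv.Perm (Fin n) :=
  if h : 0 < i ∧ i < n then Equiv.swap ⟨i - 1, by omega⟩ ⟨i, h.2⟩ else 1

/-- Coxeter length of `w ∈ S_n` = number of inversions. -/
def len (n : ℕ) (w : Equiv.Perm (Fin n)) : ℕ :=
  (Finset.univ.filter fun p : Fin n × Fin n => p.1 < p.2 ∧ w p.2 < w p.1).card

/-- `L` is a reduced word for `w`: a list of indices in `[n-1]` of length `ℓ(w)` whose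
associated product of simple transpositions is `w`. -/
def IsRedWord (n : ℕ) (L : List ℕ) (w : Equiv.Perm (Fin n)) : Prop :=
  (∀ i ∈ L, 1 ≤ i ∧ i ≤ n - 1) ∧ (L.map (st n)).prod = w ∧ L.length = len n w

/-- The left descent set `J(w) = {j ∈ [n-1] : ℓ(s_j w) < ℓ(w)}`. -/
def Descents (n : ℕ) (w : Equiv.Perm (Fin n)) : Set ℕ :=
  {j | 1 ≤ j ∧ j ≤ n - 1 ∧ len n (st n j * w) < len n w}

/-- The parabolic subgroup of `S_n` generated by `{s_i : i ∈ I}`. -/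
def parab (n : ℕ) (I : Set ℕ) : Subgroup (Equiv.Perm (Fin n)) :=
  Subgroup.closure (st n '' I)

/-- `u = w_0(I)`, the longest element of the parabolic subgroup generated by `{s_i : i ∈ I}`. -/
def IsLongest (n : ℕ) (I : Set ℕ) (u : Equiv.Perm (Fin n)) : Prop :=
  u ∈ parab n I ∧ ∀ v ∈ parab n I, len n v ≤ len n u

/-- `c` is a standard Coxeter element of some parabolic subgroup of `S_n`: a product of
the elements of some subset of `{s_1, …, s_{n-1}}`, each appearing exactly once, in some order. -/
def IsStdCox (n : ℕ) (c : Equiv.Perm (Fin n)) : Prop :=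
  ∃ L : List ℕ, L.Nodup ∧ (∀ i ∈ L, 1 ≤ i ∧ i ≤ n - 1) ∧ (L.map (st n)).prod = c

/-- A weak composition `β : Fin n → ℕ` as an exponent vector. -/
def expOf (n : ℕ) (β : Fin n → ℕ) : Fin n →₀ ℕ := Finsupp.equivFunOnFinite.symm β

/-- The monomial `x^β = x_1^{β_1} ⋯ x_n^{β_n}`. -/
def mono (n : ℕ) (β : Fin n → ℕ) : MvPolynomial (Fin n) ℤ := monomial (expOf n β) 1

/-- The coefficient `[x^β] f`. -/
def coeffOf (n : ℕ) (β : Fin n → ℕ) (f : MvPolynomial (Fin n) ℤ) : ℤ := coeff (expOf n β) f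

/-- The isobaric divided difference (Demazure) operator
`π_i(f) = (x_i f − x_{i+1} s_i f)/(x_i − x_{i+1})` (1-indexed `i`), defined as the unique
polynomial `g` with `(x_i − x_{i+1})·g = x_i f − x_{i+1} s_i f`; such a `g` always exists
and is unique since `ℤ[x_1,…,x_n]` is a domain. -/
def dem (n : ℕ) (i : ℕ) (f : MvPolynomial (Fin n) ℤ) : MvPolynomial (Fin n) ℤ :=
  if h : 0 < i ∧ i < n then
    if hg : ∃ g, (X (⟨i - 1, by omega⟩ : Fin n) - X (⟨i, h.2⟩ : Fin n)) * g =
        X (⟨i - 1, by omega⟩ : Fin n) * f -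
          X (⟨i, h.2⟩ : Fin n) *
            rename (⇑(Equiv.swap (⟨i - 1, by omega⟩ : Fin n) (⟨i, h.2⟩ : Fin n))) f then
      hg.choose
    else 0
  else f

/-- `π_{i_1} π_{i_2} ⋯ π_{i_ℓ} (f)` for a word `L = [i_1, …, i_ℓ]`. -/
def demWord (n : ℕ) (L : List ℕ) (f : MvPolynomial (Fin n) ℤ) : MvPolynomial (Fin n) ℤ :=
  L.foldr (dem n) f

/-- Entry accessor for a composition, 0-indexed position, default `0` out of range. -/
def ent (n : ℕ) (α : Fin n → ℕ) (p : ℕ) : ℕ := if h : p < n then α ⟨p, h⟩ else 0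

/-- Exchange the entries of `α` in (0-indexed) positions `p` and `p+1`. -/
def swapAt (n : ℕ) (p : ℕ) (α : Fin n → ℕ) : Fin n → ℕ := fun m =>
  if (m : ℕ) = p then ent n α (p + 1) else if (m : ℕ) = p + 1 then ent n α p else α m

/-- Auxiliary fuelled recursion computing the key polynomial `κ_α`:
if `α` is weakly decreasing, `κ_α = x^α`; otherwise, choosing an ascent `α_p < α_{p+1}`
(0-indexed `p`), `κ_α = π_{p+1}(κ_{α̂})` where `α̂` swaps the two entries.  The fuel
`n*n` in `keyPoly` strictly exceeds the number of co-inversions, which drops by one at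
each step, so the recursion always terminates at a weakly decreasing composition. -/
def keyAux (n : ℕ) : ℕ → (Fin n → ℕ) → MvPolynomial (Fin n) ℤ
  | 0, α => mono n α
  | k + 1, α =>
    if h : ∃ p : Fin n, ent n α p.1 < ent n α (p.1 + 1) then
      dem n (h.choose.1 + 1) (keyAux n k (swapAt n h.choose.1 α))
    else mono n α

/-- The key polynomial `κ_α`. -/
def keyPoly (n : ℕ) (α : Fin n → ℕ) : MvPolynomial (Fin n) ℤ := keyAux n (n * n) α

/-- `wλ`, the composition `(λ_{w⁻¹(1)}, …, λ_{w⁻¹(n)})`. -/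
def pact (n : ℕ) (w : Equiv.Perm (Fin n)) (lam : Fin n → ℕ) : Fin n → ℕ :=
  fun i => lam (w⁻¹ i)

/-- `lam` is a partition (weakly decreasing vector) with at most `n` parts. -/
def IsPartition (n : ℕ) (lam : Fin n → ℕ) : Prop := ∀ i j : Fin n, i ≤ j → lam j ≤ lam i

/-- Box `(c, r)` (column, row; both 1-indexed) belongs to the skyline diagram `D(α)`. -/
def InDiag (n : ℕ) (α : Fin n → ℕ) (c r : ℕ) : Prop :=
  1 ≤ c ∧ c ≤ n ∧ 1 ≤ r ∧ r ≤ ent n α (c - 1)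

/-- `F` (value of box (column, row)) is a filling of `D(α)` that is flagged (labels in
column `c` are in `{1, …, c}`) and row distinct. -/
def IsTab (n : ℕ) (α : Fin n → ℕ) (F : ℕ → ℕ → ℕ) : Prop :=
  (∀ c r, InDiag n α c r → 1 ≤ F c r ∧ F c r ≤ c) ∧
  ∀ c c' r, InDiag n α c r → InDiag n α c' r → c ≠ c' → F c r ≠ F c' r

/-- The weight of a filling: `wt(F)_i` = number of occurrences of the label `i`
(1-indexed; `Fin` position `i` records the label `i+1`). -/
def wt (n : ℕ) (α : Fin n → ℕ) (F : ℕ → ℕ → ℕ) : Fin n → ℕ := fun i =>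
  ((Finset.Icc 1 n ×ˢ Finset.Icc 1 (Finset.univ.sup α)).filter fun p =>
    InDiag n α p.1 p.2 ∧ F p.1 p.2 = i.1 + 1).card

/-- `leftmin_α(i) = min{α_j : j ≤ i}`. -/
def leftmin (n : ℕ) (α : Fin n → ℕ) (i : Fin n) : ℕ := sInf (α '' {j | j ≤ i})

/-- `rightmax_α(i) = max{α_j : j ≥ i}`. -/
def rightmax (n : ℕ) (α : Fin n → ℕ) (i : Fin n) : ℕ :=
  Finset.sup (Finset.univ.filter fun j => i ≤ j) α

/-- `d` records `0 = d_0 < d_1 < ⋯ < d_k < d_{k+1} = n`. -/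
def BlockData (n k : ℕ) (d : Fin (k + 2) → ℕ) : Prop :=
  d 0 = 0 ∧ d (Fin.last (k + 1)) = n ∧ StrictMono d

/-- `D = {d_1, …, d_k}` as a set of natural numbers. -/
def Dset (k : ℕ) (d : Fin (k + 2) → ℕ) : Set ℕ :=
  {m | ∃ t : Fin (k + 2), t ≠ 0 ∧ t ≠ Fin.last (k + 1) ∧ d t = m}

/-- `I = [n−1] ∖ D`. -/
def Iset (n k : ℕ) (d : Fin (k + 2) → ℕ) : Set ℕ :=
  {m | 1 ≤ m ∧ m ≤ n - 1 ∧ m ∉ Dset k d}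

/-- Positions `i, j` (of `Fin n`, 0-indexed; 1-indexed letters `i+1, j+1`) lie in the same
block: some `t` has `d_t < i+1, j+1 ≤ d_{t+1}`. -/
def SameBlock (n k : ℕ) (d : Fin (k + 2) → ℕ) (i j : Fin n) : Prop :=
  ∃ t : Fin (k + 1), d t.castSucc ≤ i.1 ∧ i.1 < d t.succ ∧ d t.castSucc ≤ j.1 ∧ j.1 < d t.succ

/-- The variables `X_t = {x_{d_t + 1}, …, x_{d_{t+1}}}` of the `t`-th block. -/
def blockVars (n k : ℕ) (d : Fin (k + 2) → ℕ) (t : Fin (k + 1)) : Finset (Fin n) :=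
  Finset.univ.filter fun p => d t.castSucc ≤ p.1 ∧ p.1 < d t.succ

/-- Complete homogeneous symmetric polynomial of degree `m` in the variables `S`. -/
def hPoly (n : ℕ) (S : Finset (Fin n)) (m : ℕ) : MvPolynomial (Fin n) ℤ :=
  ∑ f ∈ S.sym m, ((f : Multiset (Fin n)).map X).prod

/-- `h_z` for `z : ℤ`, with `h_z = 0` for `z < 0`. -/
def hZ (n : ℕ) (S : Finset (Fin n)) (z : ℤ) : MvPolynomial (Fin n) ℤ :=
  if 0 ≤ z then hPoly n S z.toNat else 0

/-- The Schur polynomial `s_lam` in the variable set `S`, for a partition `lam`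
(1-indexed parts, at most `t` of them), via the Jacobi–Trudi determinant
`det(h_{lam_i − i + j})_{1 ≤ i,j ≤ t}`. -/
def schurP (n : ℕ) (S : Finset (Fin n)) (t : ℕ) (lam : ℕ → ℕ) : MvPolynomial (Fin n) ℤ :=
  (Matrix.of fun i j : Fin t =>
    hZ n S ((lam (i.1 + 1) : ℤ) - (i.1 + 1) + (j.1 + 1))).det

/-- `γ ∈ Par_D`: a `(k+1)`-tuple of partitions, the `t`-th having at most
`d_{t+1} − d_t` nonzero parts (1-indexed parts; the unused index `0` is normalized to `0`). -/
def ParD (k : ℕ) (d : Fin (k + 2) → ℕ) (γ : Fin (k + 1) → ℕ → ℕ) : Prop :=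
  ∀ t : Fin (k + 1), γ t 0 = 0 ∧ (∀ a b : ℕ, 1 ≤ a → a ≤ b → γ t b ≤ γ t a) ∧
    ∀ m : ℕ, d t.succ - d t.castSucc < m → γ t m = 0

/-- The `D`-Schur polynomial `s_{γ^1,…,γ^{k+1}} = ∏_t s_{γ^t}(X_t)`. -/
def dSchur (n k : ℕ) (d : Fin (k + 2) → ℕ) (γ : Fin (k + 1) → ℕ → ℕ) :
    MvPolynomial (Fin n) ℤ :=
  ∏ t : Fin (k + 1), schurP n (blockVars n k d t) (d t.succ - d t.castSucc) (γ t)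

/-- Truncation of an integer vector to a natural-number vector. -/
def toNatV (n : ℕ) (β : Fin n → ℤ) : Fin n → ℕ := fun i => (β i).toNat

/-- `j − i` as an integer. -/
def gapZ (n : ℕ) (i j : Fin n) : ℤ := (j.1 : ℤ) - (i.1 : ℤ)

/-- The move `t_{ij}`: replace `β_i` by `β_j − (j−i)` and `β_j` by `β_i + (j−i)`. -/
def tmv (n : ℕ) (i j : Fin n) (β : Fin n → ℤ) : Fin n → ℤ := fun m =>
  if m = i then β j - gapZ n i j else if m = j then β i + gapZ n i j else β m

/-- The rank `θ(β) = #{(a,b) : a < b in the same block and β_a < β_b − (b−a)}`. -/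
def theta (n k : ℕ) (d : Fin (k + 2) → ℕ) (β : Fin n → ℤ) : ℕ :=
  (Finset.univ.filter fun p : Fin n × Fin n =>
    p.1 < p.2 ∧ SameBlock n k d p.1 p.2 ∧ β p.1 < β p.2 - gapZ n p.1 p.2).card

/-- One step up in the Bruhat-type order: `β ⋖ t_{ij} β` whenever `i < j` are in the same
block and `β_i > β_j − (j−i)`. -/
def stepUp (n k : ℕ) (d : Fin (k + 2) → ℕ) (β β' : Fin n → ℤ) : Prop :=
  ∃ i j : Fin n, i < j ∧ SameBlock n k d i j ∧ β j - gapZ n i j < β i ∧ β' = tmv n i j β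

/-- The order on compositions: transitive (reflexive) closure of `stepUp`. -/
def leB (n k : ℕ) (d : Fin (k + 2) → ℕ) : (Fin n → ℤ) → (Fin n → ℤ) → Prop :=
  Relation.ReflTransGen (stepUp n k d)

/-- Membership in the poset `P_{α,γ}` (for `α = cλ`): `β` is a weak composition with
`[x^β] κ_α ≠ 0` and `π_{w_0(I)}(x^β) = ± s_γ`. -/
def memP (n k : ℕ) (d : Fin (k + 2) → ℕ) (w0I : Equiv.Perm (Fin n)) (α : Fin n → ℕ)
    (γ : Fin (k + 1) → ℕ → ℕ) (β : Fin n → ℤ) : Prop :=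
  (∀ i, 0 ≤ β i) ∧ coeffOf n (toNatV n β) (keyPoly n α) ≠ 0 ∧
  ∃ L, IsRedWord n L w0I ∧
    (demWord n L (mono n (toNatV n β)) = dSchur n k d γ ∨
     demWord n L (mono n (toNatV n β)) = -dSchur n k d γ)

/-- The pair `i < j` is interweaved for `α`: `α_m ≥ α_{m+1}` for `i ≤ m < j`,
`leftmin_α(i) < α_i` and `rightmax_α(j) > α_j`. -/
def Interweaved (n : ℕ) (α : Fin n → ℕ) (i j : Fin n) : Prop :=
  i < j ∧ (∀ p : Fin n, i ≤ p → p < j → ent n α (p.1 + 1) ≤ α p) ∧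
  leftmin n α i < α i ∧ α j < rightmax n α j

/-- `center_α(i,j) = max{m : i ≤ m ≤ j and α_m ≥ rightmax_α(j)}` (as a 0-indexed position). -/
def center (n : ℕ) (α : Fin n → ℕ) (i j : Fin n) : ℕ :=
  Finset.sup (Finset.univ.filter fun p : Fin n => i ≤ p ∧ p ≤ j ∧ rightmax n α j ≤ α p)
    fun p => p.1

/-- Partial sum `β_1 + ⋯ + β_{m+1}` (0-indexed positions `≤ m`) of an integer vector. -/
def psumZ (n : ℕ) (β : Fin n → ℤ) (m : ℕ) : ℤ :=
  ∑ p ∈ Finset.univ.filter (fun p : Fin n => p.1 ≤ m), β p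

/-- Partial sum of a composition, as an integer. -/
def psumN (n : ℕ) (α : Fin n → ℕ) (m : ℕ) : ℤ :=
  ∑ p ∈ Finset.univ.filter (fun p : Fin n => p.1 ≤ m), (α p : ℤ)

/-- Composition pattern containment. -/
def ContainsPat (n : ℕ) {m : ℕ} (α : Fin n → ℕ) (pat : Fin m → ℕ) : Prop :=
  ∃ g : Fin m → Fin n, StrictMono g ∧
    (∀ s t : Fin m, pat s ≤ pat t ↔ α (g s) ≤ α (g t)) ∧
    ∀ s t : Fin m, |(pat s : ℤ) - (pat t : ℤ)| ≤ |(α (g s) : ℤ) - (α (g t) : ℤ)|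

end

end LSS
namespace LSS


/-- simple transposition on ℕ -/
def S (i : ℕ) : Equiv.Perm ℕ := Equiv.swap (i - 1) i

/-- product of a word in the infinite symmetric group -/
def P (L : List ℕ) : Equiv.Perm ℕ := (L.map S).prod

lemma P_nil : P [] = 1 := rfl

lemma P_snoc (L : List ℕ) (j : ℕ) : P (L ++ [j]) = P L * S j := by simp [P]

lemma P_append (L M : List ℕ) : P (L ++ M) = P L * P M := by simp [P]

lemma P_snoc_apply (L : List ℕ) (j y : ℕ) : P (L ++ [j]) y = P L (S j y) := by
  rw [P_snoc]; rfl

lemma S_left (j : ℕ) : S j (j - 1) = j := Equiv.swap_apply_left _ _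

lemma S_right (j : ℕ) : S j j = j - 1 := Equiv.swap_apply_right _ _

lemma S_ne {j y : ℕ} (h1 : y ≠ j - 1) (h2 : y ≠ j) : S j y = y :=
  Equiv.swap_apply_of_ne_of_ne h1 h2

lemma S_apply (j y : ℕ) : S j y = if y = j - 1 then j else if y = j then j - 1 else y :=
  Equiv.swap_apply_def _ _ _

lemma S_symm (j : ℕ) : (S j).symm = S j := Equiv.symm_swap _ _

lemma S_mul_self (j : ℕ) : S j * S j = 1 := Equiv.swap_mul_self _ _

/-- stepwise condition along a word -/
inductive Steps (R : List ℕ → ℕ → Prop) : List ℕ → Prop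
  | nil : Steps R []
  | snoc (L : List ℕ) (j : ℕ) : Steps R L → R L j → Steps R (L ++ [j])

lemma steps_snoc {R : List ℕ → ℕ → Prop} {L : List ℕ} {j : ℕ} (h : Steps R (L ++ [j])) :
    Steps R L ∧ R L j := by
  generalize hM : L ++ [j] = M at h
  cases h with
  | nil => simp at hM
  | snoc L' j' h1 h2 =>
    have h3 := List.append_inj' hM rfl
    obtain ⟨h4, h5⟩ := h3
    simp at h5
    subst h4 h5
    exact ⟨h1, h2⟩

/-- ascending step -/
def Asc (L : List ℕ) (j : ℕ) : Prop := P L (j - 1) < P L j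

/-- same block -/
def SB (E : Set ℕ) (a b : ℕ) : Prop := ∀ m ∈ E, (a < m ↔ b < m)

/-- external ascending step -/
def Ext (E : Set ℕ) (L : List ℕ) (j : ℕ) : Prop :=
  P L (j - 1) < P L j ∧ ¬ SB E (P L (j - 1)) (P L j)

/-- block preserving -/
def BP (E : Set ℕ) (u : Equiv.Perm ℕ) : Prop := ∀ a, SB E (u a) a

/-- increasing on blocks -/
def BI (E : Set ℕ) (u : Equiv.Perm ℕ) : Prop := ∀ a b, a < b → SB E a b → u a < u b

/-- decreasing on blocks -/
def BD (E : Set ℕ) (u : Equiv.Perm ℕ) : Prop := ∀ a b, a < b → SB E a b → u b < u a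

lemma SB.symm {E : Set ℕ} {a b : ℕ} (h : SB E a b) : SB E b a := fun m hm => (h m hm).symm

lemma SB.trans {E : Set ℕ} {a b c : ℕ} (h : SB E a b) (h' : SB E b c) : SB E a c :=
  fun m hm => (h m hm).trans (h' m hm)

lemma SB.refl (E : Set ℕ) (a : ℕ) : SB E a a := fun _ _ => Iff.rfl

lemma BP.mul {E : Set ℕ} {u v : Equiv.Perm ℕ} (hu : BP E u) (hv : BP E v) : BP E (u * v) :=
  fun a => (hu (v a)).trans (hv a)

lemma BP.one (E : Set ℕ) : BP E 1 := fun a => SB.refl E a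

lemma BP.inv {E : Set ℕ} {u : Equiv.Perm ℕ} (hu : BP E u) : BP E u⁻¹ := fun a => by
  have := hu (u⁻¹ a)
  have h2 : u (u⁻¹ a) = a := u.apply_symm_apply a
  rw [h2] at this
  exact this.symm

lemma BP.swap {E : Set ℕ} {a b : ℕ} (h : SB E a b) : BP E (Equiv.swap a b) := fun c => by
  rw [Equiv.swap_apply_def]
  split_ifs with h1 h2
  · subst h1; exact h.symm
  · subst h2; exact h
  · exact SB.refl _ _

lemma not_SB {E : Set ℕ} {a b : ℕ} (hab : a < b) (h : ¬ SB E a b) : ∃ m ∈ E, a < m ∧ m ≤ b := by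
  unfold SB at h
  push Not at h
  obtain ⟨m, hm, h⟩ := h
  refine ⟨m, hm, ?_⟩
  omega

lemma BP.lt {E : Set ℕ} {u : Equiv.Perm ℕ} (hu : BP E u) {a b : ℕ} (hab : a < b)
    (h : ¬ SB E a b) : u a < u b := by
  obtain ⟨m, hm, h1, h2⟩ := not_SB hab h
  have h3 := hu a m hm
  have h4 := hu b m hm
  omega

lemma eq_one {E : Set ℕ} {u : Equiv.Perm ℕ} (hu : BP E u) (hi : BI E u) : u = 1 := by
  have hs : StrictMono u := by
    intro a b hab
    by_cases h : SB E a b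
    · exact hi a b hab h
    · exact hu.lt hab h
  have hs' : StrictMono u.symm := by
    intro a b hab
    by_contra hc
    have := hs.monotone (not_lt.mp hc)
    simp at this
    omega
  ext a
  have h1 := hs.id_le a
  have h2 := hs'.id_le (u a)
  simp at h1 h2
  simp
  omega

lemma BD.inv {E : Set ℕ} {u : Equiv.Perm ℕ} (hu : BP E u) (hd : BD E u) : BD E u⁻¹ := by
  intro a b hab h
  by_contra hc
  have hne : u⁻¹ a ≠ u⁻¹ b := fun h => by
    have := u⁻¹.injective h; omega
  have h1 : u⁻¹ a < u⁻¹ b := by omega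
  have h2 := hd _ _ h1 (((hu.inv a).trans h).trans (hu.inv b).symm)
  simp at h2
  omega

lemma BD.mul {E : Set ℕ} {u v : Equiv.Perm ℕ} (hu : BD E u) (hv : BD E v) (hp : BP E v) :
    BI E (u * v) := by
  intro a b hab h
  exact hu _ _ (hv a b hab h) (((hp b).trans h.symm).trans (hp a).symm)

/-- inversions (in position form) -/
def Inv (n : ℕ) (u : Equiv.Perm ℕ) : Finset (ℕ × ℕ) :=
  (Finset.range n ×ˢ Finset.range n).filter fun p => p.1 < p.2 ∧ u.symm p.2 < u.symm p.1

lemma mem_Inv {n : ℕ} {u : Equiv.Perm ℕ} {a b : ℕ} :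
    (a, b) ∈ Inv n u ↔ b < n ∧ a < b ∧ u.symm b < u.symm a := by
  simp [Inv]; omega

/-- fixes everything from n on -/
def Fx (n : ℕ) (u : Equiv.Perm ℕ) : Prop := ∀ y, n ≤ y → u y = y

lemma Fx.lt {n : ℕ} {u : Equiv.Perm ℕ} (h : Fx n u) {y : ℕ} (hy : y < n) : u y < n := by
  by_contra hc
  have := h (u y) (by omega)
  have := u.injective this
  omega

lemma Fx.symm {n : ℕ} {u : Equiv.Perm ℕ} (h : Fx n u) : Fx n u.symm := fun y hy => by
  rw [Equiv.symm_apply_eq, h y hy]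

lemma Fx.mul {n : ℕ} {u v : Equiv.Perm ℕ} (h : Fx n u) (h' : Fx n v) : Fx n (u * v) :=
  fun y hy => by simp [h' y hy, h y hy]

lemma Fx.S {n j : ℕ} (hj : j < n) : Fx n (S j) := fun y hy => S_ne (by omega) (by omega)

lemma Fx.P {n : ℕ} {L : List ℕ} (hL : ∀ i ∈ L, 1 ≤ i ∧ i < n) : Fx n (P L) := by
  induction L using List.reverseRecOn with
  | nil => intro y _; rfl
  | append_singleton L j ih =>
    rw [P_snoc]
    exact Fx.mul (ih fun i hi => hL i (by simp [hi])) (Fx.S (hL j (by simp)).2)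

lemma mul_S_symm (u : Equiv.Perm ℕ) (j a : ℕ) : (u * S j).symm a = S j (u.symm a) := by
  have h := S_symm j
  change (S j).symm (u.symm a) = _
  rw [h]

lemma S_lt {j x y : ℕ} (hj : 1 ≤ j) (hxy : x < y) (h : ¬ (x = j - 1 ∧ y = j)) : S j x < S j y := by
  rw [S_apply, S_apply]; split_ifs <;> omega

lemma Inv_step {n j : ℕ} {u : Equiv.Perm ℕ} (hu : Fx n u) (h1 : 1 ≤ j) (hj : j < n)
    (h : u (j - 1) < u j) :
    (u (j - 1), u j) ∉ Inv n u ∧ Inv n (u * S j) = insert (u (j - 1), u j) (Inv n u) := by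
  constructor
  · rw [mem_Inv]; simp
  · ext ⟨a, b⟩
    rw [Finset.mem_insert, mem_Inv, mem_Inv, mul_S_symm, mul_S_symm, Prod.mk.injEq]
    have hb := hu.lt hj
    constructor
    · rintro ⟨h2, h3, h4⟩
      by_cases hc : u.symm b < u.symm a
      · exact Or.inr ⟨h2, h3, hc⟩
      · left
        have hne : u.symm a ≠ u.symm b := fun h => by
          have := u.symm.injective h; omega
        by_cases h5 : u.symm a = j - 1 ∧ u.symm b = j
        · have h6 : u (u.symm a) = a := u.apply_symm_apply a
          have h7 : u (u.symm b) = b := u.apply_symm_apply b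
          rw [h5.1] at h6
          rw [h5.2] at h7
          exact ⟨h6.symm, h7.symm⟩
        · have := S_lt h1 (show u.symm a < u.symm b by omega) h5
          omega
    · rintro (⟨rfl, rfl⟩ | ⟨h2, h3, h4⟩)
      · refine ⟨hb, h, ?_⟩
        simp [S_left, S_right]; omega
      · refine ⟨h2, h3, ?_⟩
        apply S_lt h1 h4
        rintro ⟨h5, h6⟩
        rw [Equiv.symm_apply_eq] at h5 h6
        omega

lemma Inv_card {n j : ℕ} {u : Equiv.Perm ℕ} (hu : Fx n u) (h1 : 1 ≤ j) (hj : j < n)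
    (h : u (j - 1) < u j) : (Inv n (u * S j)).card = (Inv n u).card + 1 := by
  obtain ⟨h2, h3⟩ := Inv_step hu h1 hj h
  rw [h3, Finset.card_insert_of_notMem h2]

lemma Inv_card' {n j : ℕ} {u : Equiv.Perm ℕ} (hu : Fx n u) (h1 : 1 ≤ j) (hj : j < n)
    (h : u j < u (j - 1)) : (Inv n u).card = (Inv n (u * S j)).card + 1 := by
  have := Inv_card (u := u * S j) (hu.mul (Fx.S hj)) h1 hj (by simp [S_left, S_right, h])
  rwa [mul_assoc, S_mul_self, mul_one] at this

lemma Inv_inv {n : ℕ} {u : Equiv.Perm ℕ} (hu : Fx n u) : (Inv n u⁻¹).card = (Inv n u).card := by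
  refine Finset.card_nbij' (fun p => (u p.2, u p.1)) (fun p => (u.symm p.2, u.symm p.1)) ?_ ?_ ?_ ?_
  · rintro ⟨a, b⟩ h
    simp only [Finset.mem_coe, mem_Inv] at h ⊢
    change b < n ∧ a < b ∧ u b < u a at h
    exact ⟨hu.lt (by omega), h.2.2, by simpa using h.2.1⟩
  · rintro ⟨a, b⟩ h
    simp only [Finset.mem_coe, mem_Inv] at h ⊢
    refine ⟨hu.symm.lt (by omega), h.2.2, ?_⟩
    change u (u.symm a) < u (u.symm b)
    simpa using h.2.1
  · rintro ⟨a, b⟩ h; simp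
  · rintro ⟨a, b⟩ h; simp

lemma P_ne {L : List ℕ} {j : ℕ} (hj : 1 ≤ j) : P L (j - 1) ≠ P L j := fun h => by
  have := (P L).injective h; omega

lemma Inv_one (n : ℕ) : Inv n 1 = ∅ := by
  ext ⟨a, b⟩
  rw [mem_Inv]
  change (b < n ∧ a < b ∧ b < a) ↔ _
  simp only [Finset.notMem_empty, iff_false]
  omega

lemma asc_card {n : ℕ} {L : List ℕ} (hL : ∀ i ∈ L, 1 ≤ i ∧ i < n) (h : Steps Asc L) :
    (Inv n (P L)).card = L.length := by
  induction h with
  | nil => simp [P_nil, Inv_one]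
  | snoc L j h1 h2 ih =>
    have hj := hL j (by simp)
    have hL' : ∀ i ∈ L, 1 ≤ i ∧ i < n := fun i hi => hL i (by simp [hi])
    rw [P_snoc, Inv_card (Fx.P hL') hj.1 hj.2 h2, ih hL']
    simp

lemma card_asc {n : ℕ} {L : List ℕ} (hL : ∀ i ∈ L, 1 ≤ i ∧ i < n) :
    (Inv n (P L)).card ≤ L.length ∧ ((Inv n (P L)).card = L.length → Steps Asc L) := by
  induction L using List.reverseRecOn with
  | nil => exact ⟨by simp [P_nil, Inv_one], fun _ => Steps.nil⟩
  | append_singleton L j ih =>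
    have hj := hL j (by simp)
    have hL' : ∀ i ∈ L, 1 ≤ i ∧ i < n := fun i hi => hL i (by simp [hi])
    obtain ⟨ih1, ih2⟩ := ih hL'
    rw [P_snoc]
    simp only [List.length_append, List.length_singleton]
    rcases lt_or_gt_of_ne (P_ne (L := L) hj.1) with h | h
    · rw [Inv_card (Fx.P hL') hj.1 hj.2 h]
      exact ⟨by omega, fun h' => Steps.snoc _ _ (ih2 (by omega)) h⟩
    · have := Inv_card' (Fx.P hL') hj.1 hj.2 h
      exact ⟨by omega, fun h' => by omega⟩

/- crossing lemmas -/

lemma cross0 {m : ℕ} {L : List ℕ} (hm : m ∉ L) (hL : ∀ i ∈ L, 1 ≤ i) (y : ℕ) :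
    P L y < m ↔ y < m := by
  induction L using List.reverseRecOn generalizing y with
  | nil => rfl
  | append_singleton L j ih =>
    have hj := hL j (by simp)
    simp at hm
    rw [P_snoc_apply, ih (by tauto) (fun i hi => hL i (by simp [hi]))]
    rw [S_apply]; split_ifs <;> omega

lemma cross1 {m : ℕ} {L : List ℕ} (hm : L.count m ≤ 1) (hL : ∀ i ∈ L, 1 ≤ i) {y z : ℕ}
    (hy : m ≤ y) (hz : m ≤ z) (h1 : P L y < m) (h2 : P L z < m) : y = z := by
  induction L using List.reverseRecOn generalizing y z with
  | nil => simp [P_nil] at h1; omega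
  | append_singleton L j ih =>
    have hj := hL j (by simp)
    have hL' : ∀ i ∈ L, 1 ≤ i := fun i hi => hL i (by simp [hi])
    rw [P_snoc_apply] at h1 h2
    by_cases hjm : j = m
    · subst hjm
      have hn : j ∉ L := by
        rw [← List.count_eq_zero]; simp at hm; simpa using hm
      rw [cross0 hn hL'] at h1 h2
      rw [S_apply] at h1 h2
      split_ifs at h1 h2 <;> omega
    · apply (S j).injective
      refine ih ?_ hL' ?_ ?_ h1 h2
      · rw [List.count_append] at hm; omega
      · rw [S_apply]; split_ifs <;> omega
      · rw [S_apply]; split_ifs <;> omega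

lemma cross1' {m : ℕ} {L : List ℕ} (hm : L.count m ≤ 1) (hL : ∀ i ∈ L, 1 ≤ i) {y z : ℕ}
    (hy : y < m) (hz : z < m) (h1 : m ≤ P L y) (h2 : m ≤ P L z) : y = z := by
  induction L using List.reverseRecOn generalizing y z with
  | nil => simp [P_nil] at h1; omega
  | append_singleton L j ih =>
    have hj := hL j (by simp)
    have hL' : ∀ i ∈ L, 1 ≤ i := fun i hi => hL i (by simp [hi])
    rw [P_snoc_apply] at h1 h2
    by_cases hjm : j = m
    · subst hjm
      have hn : j ∉ L := by
        rw [← List.count_eq_zero]; simp at hm; simpa using hm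
      rw [← not_lt, cross0 hn hL'] at h1 h2
      rw [S_apply] at h1 h2
      split_ifs at h1 h2 <;> omega
    · apply (S j).injective
      refine ih ?_ hL' ?_ ?_ h1 h2
      · rw [List.count_append] at hm; omega
      · rw [S_apply]; split_ifs <;> omega
      · rw [S_apply]; split_ifs <;> omega

/-- consecutive block boundaries -/
def Blk (E : Set ℕ) (p q : ℕ) : Prop := q ∈ E ∧ (p = 0 ∨ p ∈ E) ∧ ∀ m ∈ E, m ≤ p ∨ q ≤ m

lemma Blk.SB {E : Set ℕ} {p q a b : ℕ} (h : Blk E p q) (ha : p ≤ a) (ha' : a < q) (hb : p ≤ b)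
    (hb' : b < q) : SB E a b := fun m hm => by
  have := h.2.2 m hm
  omega

/-- inversions inside a block -/
def InvB (n p q : ℕ) (u : Equiv.Perm ℕ) : Finset (ℕ × ℕ) :=
  (Inv n u).filter fun z => p ≤ z.1 ∧ z.2 < q

/-- number of letters strictly inside a block -/
def cnt (p q : ℕ) (L : List ℕ) : ℕ := L.countP fun m => decide (p < m ∧ m < q)

lemma cnt_append (p q : ℕ) (L M : List ℕ) : cnt p q (L ++ M) = cnt p q L + cnt p q M :=
  List.countP_append

lemma cnt_single (p q j : ℕ) : cnt p q [j] = if p < j ∧ j < q then 1 else 0 := by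
  unfold cnt
  by_cases h : p < j ∧ j < q <;> simp [h]

lemma phase1 {n : ℕ} {E : Set ℕ} {L : List ℕ} (hL : ∀ i ∈ L, 1 ≤ i ∧ i < n)
    (hasc : Steps Asc L) (hE : ∀ m ∈ E, L.count m ≤ 1) :
    ∃ (L' : List ℕ) (y : Equiv.Perm ℕ), P L = y * P L' ∧ BP E y ∧ Steps (Ext E) L' ∧
      (∀ m, L'.count m ≤ L.count m) ∧
      ∀ p q, Blk E p q → cnt p q L' + (InvB n p q (P L)).card ≤ cnt p q L := by
  induction hasc with
  | nil =>
    refine ⟨[], 1, by simp [P_nil], BP.one E, Steps.nil, fun m => le_rfl, fun p q _ => ?_⟩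
    simp [P_nil, InvB, Inv_one]
  | snoc L j h1 h2 ih =>
    have hj := hL j (by simp)
    have hL' : ∀ i ∈ L, 1 ≤ i ∧ i < n := fun i hi => hL i (by simp [hi])
    have hL1 : ∀ i ∈ L, 1 ≤ i := fun i hi => (hL' i hi).1
    have hE' : ∀ m ∈ E, L.count m ≤ 1 := fun m hm => by
      have := hE m hm
      rw [List.count_append] at this
      omega
    have hnot : j ∈ E → j ∉ L := fun hm => by
      have := hE j hm
      rw [← List.count_eq_zero]; simp at this; simpa using this
    obtain ⟨L', y, e1, e2, e3, e4, e5⟩ := ih hL' hE'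
    have hInv := Inv_step (Fx.P hL') hj.1 hj.2 h2
    have ha : P L (j - 1) = y (P L' (j - 1)) := by rw [e1]; rfl
    have hb : P L j = y (P L' j) := by rw [e1]; rfl
    by_cases hs : SB E (P L (j - 1)) (P L j)
    · have hs' : SB E (P L' (j - 1)) (P L' j) := by
        rw [ha, hb] at hs
        exact ((e2 _).symm.trans hs).trans (e2 _)
      refine ⟨L', y * Equiv.swap (P L' (j - 1)) (P L' j), ?_, e2.mul (BP.swap hs'), e3, ?_, ?_⟩
      · rw [P_snoc, e1, mul_assoc, mul_assoc]
        congr 1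
        rw [Equiv.swap_apply_apply]
        simp [S]
      · intro m
        rw [List.count_append]
        have := e4 m
        omega
      · intro p q hpq
        have h5 := e5 p q hpq
        rw [cnt_append, cnt_single, P_snoc]
        unfold InvB at h5 ⊢
        rw [hInv.2, Finset.filter_insert]
        split_ifs with h6 h7
        · have := Finset.card_insert_le (P L (j - 1), P L j)
            (Finset.filter (fun z => p ≤ z.1 ∧ z.2 < q) (Inv n (P L)))
          omega
        · exfalso
          apply h7
          simp only at h6
          have h2' : P L (j - 1) < P L j := h2
          constructor
          · by_contra hc
            rcases hpq.2.1 with h0 | h0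
            · omega
            · rcases lt_or_eq_of_le (not_lt.mp hc) with h8 | h8
              · have := cross1' (hE' p h0) hL1 (y := j - 1) (z := j) (by omega) h8
                  (by omega) (by omega)
                omega
              · have := (cross0 (hnot (h8 ▸ h0)) hL1 (j - 1)).2 (by omega)
                omega
          · by_contra hc
            have h0 := hpq.1
            rcases lt_or_eq_of_le (not_lt.mp hc) with h8 | h8
            · have := cross1 (hE' q h0) hL1 (y := j - 1) (z := j) (by omega) (by omega)
                (by omega) (by omega)
              omega
            · have := (cross0 (hnot (h8 ▸ h0)) hL1 j).1 (by omega)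
              omega
        · omega
        · omega
    · refine ⟨L' ++ [j], y, ?_, e2, Steps.snoc _ _ e3 ⟨?_, ?_⟩, ?_, ?_⟩
      · rw [P_snoc, P_snoc, e1, mul_assoc]
      · obtain ⟨m, hm, h5, h6⟩ := not_SB h2 hs
        have h7 := e2 (P L' (j - 1)) m hm
        have h8 := e2 (P L' j) m hm
        rw [← ha] at h7
        rw [← hb] at h8
        omega
      · intro hs'
        apply hs
        rw [ha, hb]
        exact ((e2 _).trans hs').trans (e2 _).symm
      · intro m
        rw [List.count_append, List.count_append]
        have := e4 m
        omega
      · intro p q hpq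
        have h5 := e5 p q hpq
        rw [cnt_append, cnt_append, P_snoc]
        unfold InvB at h5 ⊢
        rw [hInv.2, Finset.filter_insert, if_neg]
        · omega
        · rintro ⟨h6, h7⟩
          simp only at h6 h7
          have h2' : P L (j - 1) < P L j := h2
          exact hs (hpq.SB h6 (by omega) (by omega) h7)

lemma ext_BI {E : Set ℕ} {L : List ℕ} (hL : ∀ i ∈ L, 1 ≤ i) (h : Steps (Ext E) L) :
    BI E (P L)⁻¹ := by
  induction h with
  | nil => intro a b hab _; exact hab
  | snoc L j h1 h2 ih =>
    intro a b hab hs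
    have hj := hL j (by simp)
    have h3 := ih (fun i hi => hL i (by simp [hi])) a b hab hs
    rw [P_snoc]
    change (P L * S j).symm a < (P L * S j).symm b
    rw [mul_S_symm, mul_S_symm]
    apply S_lt hj h3
    rintro ⟨h4, h5⟩
    change (P L).symm a = _ at h4
    change (P L).symm b = _ at h5
    rw [Equiv.symm_apply_eq] at h4 h5
    apply h2.2
    rw [← h4, ← h5]
    exact hs

lemma asc_BI {E : Set ℕ} {L : List ℕ} (hL : ∀ i ∈ L, 1 ≤ i) (h : Steps Asc L)
    (hi : BI E (P L)⁻¹) : Steps (Ext E) L := by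
  induction h with
  | nil => exact Steps.nil
  | snoc L j h1 h2 ih =>
    have hj := hL j (by simp)
    have h2' : P L (j - 1) < P L j := h2
    rw [P_snoc] at hi
    have hi' : ∀ a b, a < b → SB E a b → S j ((P L).symm a) < S j ((P L).symm b) := by
      intro a b hab hs
      rw [← mul_S_symm, ← mul_S_symm]
      exact hi a b hab hs
    refine Steps.snoc _ _ (ih (fun i hi => hL i (by simp [hi])) ?_) ⟨h2, ?_⟩
    · intro a b hab hs
      change (P L).symm a < (P L).symm b
      by_contra hc
      have hne : (P L).symm a ≠ (P L).symm b := fun h => by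
        have := (P L).symm.injective h; omega
      have h3 := hi' a b hab hs
      have h4 := S_lt hj (show (P L).symm b < (P L).symm a by omega) (by
        rintro ⟨h4, h5⟩
        rw [Equiv.symm_apply_eq] at h4 h5
        omega)
      omega
    · intro hs
      have := hi' _ _ h2 hs
      simp [S_left, S_right] at this
      omega

lemma nodup_asc {L : List ℕ} (hL : ∀ i ∈ L, 1 ≤ i) (h : L.Nodup) : Steps Asc L := by
  induction L using List.reverseRecOn with
  | nil => exact Steps.nil
  | append_singleton L j ih =>
    have hj := hL j (by simp)
    have hL' : ∀ i ∈ L, 1 ≤ i := fun i hi => hL i (by simp [hi])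
    have hn : L.Nodup ∧ j ∉ L := by
      rw [List.nodup_append] at h
      refine ⟨h.1, fun hc => h.2.2 j hc j (by simp) rfl⟩
    refine Steps.snoc _ _ (ih hL' hn.1) ?_
    have h1 := (cross0 hn.2 hL' (j - 1)).2 (by omega)
    have h2 := (cross0 hn.2 hL' j)
    unfold Asc
    omega

lemma left_once {E : Set ℕ} {L : List ℕ} (hL : ∀ i ∈ L, 1 ≤ i) (h : Steps (Ext E) L) {p m i : ℕ}
    (hE : ∀ e ∈ E, e ≤ p ∨ m < e) (hp : L.count p ≤ 1) (hm : m ∉ L) (hpi : p < i) (him : i < m) :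
    (i ∈ L → ∃ y, i ≤ y ∧ y < m ∧ P L y < p) ∧ L.count i ≤ 1 := by
  induction h with
  | nil => simp
  | snoc L j h1 h2 ih =>
    have hj := hL j (by simp)
    have hL' : ∀ i ∈ L, 1 ≤ i := fun i hi => hL i (by simp [hi])
    have hm' : m ∉ L ∧ m ≠ j := by simpa using hm
    have hp' : L.count p ≤ 1 := by rw [List.count_append] at hp; omega
    obtain ⟨ih1, ih2⟩ := ih hL' hp' hm'.1
    have hlt : P L (j - 1) < P L j := h2.1
    have hmem : i ∈ L ++ [j] ↔ i ∈ L ∨ i = j := by simp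
    rw [hmem]
    by_cases hjm : p < j ∧ j < m
    · have hb := (cross0 hm'.1 hL' j).2 hjm.2
      have ha : P L (j - 1) < p := by
        by_contra hc
        apply h2.2
        intro e he
        have := hE e he
        omega
      have hj' : P (L ++ [j]) j < p := by rw [P_snoc_apply, S_right]; exact ha
      have hyj : ∀ y, p ≤ y → P L y < p → y = j - 1 := fun y hy1 hy2 =>
        cross1 hp' hL' hy1 (by omega) hy2 ha
      constructor
      · rintro (hi | hi)
        · obtain ⟨y, hy1, hy2, hy3⟩ := ih1 hi
          have := hyj y (by omega) hy3
          exact ⟨j, by omega, hjm.2, hj'⟩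
        · exact ⟨j, by omega, hjm.2, hj'⟩
      · by_cases hij : i = j
        · have : i ∉ L := fun hi => by
            obtain ⟨y, hy1, hy2, hy3⟩ := ih1 hi
            have := hyj y (by omega) hy3
            omega
          rw [← List.count_eq_zero] at this
          rw [List.count_append, this, hij]; simp
        · rw [List.count_append, List.count_eq_zero.2 (show i ∉ [j] by simpa using hij)]
          omega
    · have hij : i ≠ j := by omega
      constructor
      · rintro (hi | hi)
        · obtain ⟨y, hy1, hy2, hy3⟩ := ih1 hi
          by_cases hjp : j = p
          · exfalso
            have hpn : p ∉ L := by
              rw [← List.count_eq_zero]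
              rw [hjp] at hp
              simp at hp; simpa using hp
            have := (cross0 hpn hL' y).1 hy3
            omega
          · refine ⟨y, hy1, hy2, ?_⟩
            rw [P_snoc_apply, S_ne]
            · exact hy3
            · omega
            · omega
        · exact absurd hi hij
      · rw [List.count_append, List.count_eq_zero.2 (show i ∉ [j] by simpa using hij)]
        omega

lemma right_once {E : Set ℕ} {L : List ℕ} (hL : ∀ i ∈ L, 1 ≤ i) (h : Steps (Ext E) L) {q m i : ℕ}
    (hE : ∀ e ∈ E, e ≤ m ∨ q ≤ e) (hq : L.count q ≤ 1) (hm : m ∉ L) (hmi : m < i) (hiq : i < q) :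
    (i ∈ L → ∃ y, y < i ∧ m ≤ y ∧ q ≤ P L y) ∧ L.count i ≤ 1 := by
  induction h with
  | nil => simp
  | snoc L j h1 h2 ih =>
    have hj := hL j (by simp)
    have hL' : ∀ i ∈ L, 1 ≤ i := fun i hi => hL i (by simp [hi])
    have hm' : m ∉ L ∧ m ≠ j := by simpa using hm
    have hq' : L.count q ≤ 1 := by rw [List.count_append] at hq; omega
    obtain ⟨ih1, ih2⟩ := ih hL' hq' hm'.1
    have hlt : P L (j - 1) < P L j := h2.1
    have hmem : i ∈ L ++ [j] ↔ i ∈ L ∨ i = j := by simp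
    rw [hmem]
    by_cases hjm : m < j ∧ j < q
    · have ha := (cross0 hm'.1 hL' (j - 1))
      have hb : q ≤ P L j := by
        by_contra hc
        apply h2.2
        intro e he
        have := hE e he
        omega
      have hj' : q ≤ P (L ++ [j]) (j - 1) := by rw [P_snoc_apply, S_left]; exact hb
      have hyj : ∀ y, y < q → q ≤ P L y → y = j := fun y hy1 hy2 =>
        cross1' hq' hL' hy1 (by omega) hy2 hb
      constructor
      · rintro (hi | hi)
        · obtain ⟨y, hy1, hy2, hy3⟩ := ih1 hi
          have := hyj y (by omega) hy3
          exact ⟨j - 1, by omega, by omega, hj'⟩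
        · exact ⟨j - 1, by omega, by omega, hj'⟩
      · by_cases hij : i = j
        · have : i ∉ L := fun hi => by
            obtain ⟨y, hy1, hy2, hy3⟩ := ih1 hi
            have := hyj y (by omega) hy3
            omega
          rw [← List.count_eq_zero] at this
          rw [List.count_append, this, hij]; simp
        · rw [List.count_append, List.count_eq_zero.2 (show i ∉ [j] by simpa using hij)]
          omega
    · have hij : i ≠ j := by omega
      constructor
      · rintro (hi | hi)
        · obtain ⟨y, hy1, hy2, hy3⟩ := ih1 hi
          by_cases hjp : j = q
          · exfalso
            have hpn : q ∉ L := by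
              rw [← List.count_eq_zero]
              rw [hjp] at hq
              simp at hq; simpa using hq
            have := (cross0 hpn hL' y).2 (by omega)
            omega
          · refine ⟨y, hy1, hy2, ?_⟩
            rw [P_snoc_apply, S_ne]
            · exact hy3
            · omega
            · omega
        · exact absurd hi hij
      · rw [List.count_append, List.count_eq_zero.2 (show i ∉ [j] by simpa using hij)]
        omega

lemma cnt_sum (p q : ℕ) (L : List ℕ) : cnt p q L = ∑ i ∈ Finset.Ioo p q, L.count i := by
  induction L with
  | nil => simp [cnt]
  | cons a L ih =>
    have h := cnt_append p q [a] L
    rw [List.singleton_append] at h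
    rw [h, ih, cnt_single]
    have : ∀ i, List.count i (a :: L) = (if a = i then 1 else 0) + List.count i L := fun i => by
      rw [List.count_cons]; simp [add_comm]
    simp only [this, Finset.sum_add_distrib, Finset.sum_ite_eq, Finset.mem_Ioo]

lemma phase2 {E : Set ℕ} {L : List ℕ} (hL : ∀ i ∈ L, 1 ≤ i) (h : Steps (Ext E) L)
    (hE : ∀ m ∈ E, L.count m ≤ 1) (hblk : ∀ i, 1 ≤ i → i ∉ E → ∃ p q, Blk E p q ∧ p < i ∧ i < q ∧
      cnt p q L ≤ q - p - 1) : L.Nodup := by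
  rw [List.nodup_iff_count_le_one]
  intro i
  by_cases hiE : i ∈ E
  · exact hE i hiE
  by_cases hiL : i ∈ L
  swap
  · rw [List.count_eq_zero.2 hiL]; omega
  obtain ⟨p, q, hpq, h1, h2, h3⟩ := hblk i (hL i hiL) hiE
  have hcp : L.count p ≤ 1 := by
    rcases hpq.2.1 with h0 | h0
    · rw [List.count_eq_zero.2]
      · omega
      · intro hp
        have := hL p hp
        omega
    · exact hE p h0
  by_cases hall : ∀ m, p < m → m < q → m ∈ L
  · rw [cnt_sum] at h3
    by_contra hc
    have h4 : ∑ i ∈ Finset.Ioo p q, 1 < ∑ i ∈ Finset.Ioo p q, L.count i := by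
      apply Finset.sum_lt_sum
      · intro m hm
        rw [Finset.mem_Ioo] at hm
        exact List.one_le_count_iff.2 (hall m hm.1 hm.2)
      · exact ⟨i, Finset.mem_Ioo.2 ⟨h1, h2⟩, by omega⟩
    simp at h4
    omega
  · push Not at hall
    obtain ⟨m, h3, h4, h5⟩ := hall
    have hne : i ≠ m := fun h => h5 (h ▸ hiL)
    rcases lt_or_gt_of_ne hne with h6 | h6
    · refine (left_once hL h (p := p) (m := m) ?_ hcp h5 h1 h6).2
      intro e he
      have := hpq.2.2 e he
      omega
    · refine (right_once hL h (q := q) (m := m) ?_ (hE q hpq.1) h5 h6 h2).2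
      intro e he
      have := hpq.2.2 e he
      omega

lemma BD_of_adj {E : Set ℕ} {u : Equiv.Perm ℕ} (h : ∀ j, 1 ≤ j → j ∉ E → u j < u (j - 1)) :
    BD E u := by
  intro a b hab hs
  induction b with
  | zero => omega
  | succ b ih =>
    have h1 : b + 1 ∉ E := fun he => by
      have := hs _ he
      omega
    have h2 := h (b + 1) (by omega) h1
    simp only [Nat.add_sub_cancel] at h2
    by_cases hb : a = b
    · subst hb; exact h2
    · have := ih (by omega) (fun m hm => by
        have := hs m hm
        have : m ≠ b + 1 := fun h => h1 (h ▸ hm)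
        omega)
      omega

lemma BI_of_adj {E : Set ℕ} {u : Equiv.Perm ℕ} (h : ∀ j, 1 ≤ j → j ∉ E → u (j - 1) < u j) :
    BI E u := by
  intro a b hab hs
  induction b with
  | zero => omega
  | succ b ih =>
    have h1 : b + 1 ∉ E := fun he => by
      have := hs _ he
      omega
    have h2 := h (b + 1) (by omega) h1
    simp only [Nat.add_sub_cancel] at h2
    by_cases hb : a = b
    · subst hb; exact h2
    · have := ih (by omega) (fun m hm => by
        have := hs m hm
        have : m ≠ b + 1 := fun h => h1 (h ▸ hm)
        omega)
      omega

/-- all pairs inside a block -/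
def prs (p q : ℕ) : Finset (ℕ × ℕ) :=
  (Finset.Ico p q ×ˢ Finset.Ico p q).filter fun z => z.1 < z.2

lemma prs_card (p q : ℕ) : (prs p q).card = (q - p).choose 2 := by
  rw [← Nat.card_Ico p q, ← Finset.card_powersetCard]
  refine Finset.card_nbij (fun z => {z.1, z.2}) ?_ ?_ ?_
  · rintro ⟨a, b⟩ h
    simp only [prs, Finset.coe_filter, Finset.mem_product, Finset.mem_Ico, Set.mem_ofPred_eq] at h
    simp only [Finset.mem_coe, Finset.mem_powersetCard]
    refine ⟨?_, Finset.card_pair (by omega)⟩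
    intro x hx
    simp at hx
    rw [Finset.mem_Ico]
    omega
  · rintro ⟨a, b⟩ h ⟨a', b'⟩ h' heq
    simp only [prs, Finset.coe_filter, Finset.mem_product, Finset.mem_Ico, Set.mem_ofPred_eq] at h h'
    simp only at heq
    have h1 : a ∈ ({a', b'} : Finset ℕ) := by rw [← heq]; simp
    have h2 : b ∈ ({a', b'} : Finset ℕ) := by rw [← heq]; simp
    simp at h1 h2
    rw [Prod.mk.injEq]
    omega
  · intro s hs
    simp only [Finset.mem_coe, Finset.mem_powersetCard] at hs
    obtain ⟨x, y, hxy, rfl⟩ := Finset.card_eq_two.1 hs.2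
    have hx := hs.1 (show x ∈ ({x, y} : Finset ℕ) by simp)
    have hy := hs.1 (show y ∈ ({x, y} : Finset ℕ) by simp)
    rw [Finset.mem_Ico] at hx hy
    rcases lt_or_gt_of_ne hxy with h | h
    · exact ⟨(x, y), by simp [prs]; omega, rfl⟩
    · exact ⟨(y, x), by simp [prs]; omega, by simp [Finset.pair_comm]⟩

lemma InvB_sub (n p q : ℕ) (u : Equiv.Perm ℕ) : InvB n p q u ⊆ prs p q := by
  rintro ⟨a, b⟩ h
  rw [InvB, Finset.mem_filter, mem_Inv] at h
  simp only at h
  simp [prs]; omega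

lemma InvB_full {E : Set ℕ} {n p q : ℕ} {u : Equiv.Perm ℕ} (hq : q ≤ n) (hpq : Blk E p q)
    (hu : BD E u⁻¹) : InvB n p q u = prs p q := by
  apply Finset.Subset.antisymm (InvB_sub n p q u)
  rintro ⟨a, b⟩ h
  simp [prs] at h
  rw [InvB, Finset.mem_filter, mem_Inv]
  simp only
  refine ⟨⟨by omega, h.2, ?_⟩, by omega, by omega⟩
  exact hu a b h.2 (hpq.SB (by omega) (by omega) (by omega) (by omega))

/-- block preserving permutations have ascending words in internal letters -/
lemma exists_word {E : Set ℕ} {n : ℕ} (hE : ∀ m, n ≤ m → m ∈ E) (u : Equiv.Perm ℕ) (hf : Fx n u)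
    (hu : BP E u) : ∃ L : List ℕ, (∀ i ∈ L, 1 ≤ i ∧ i < n ∧ i ∉ E) ∧ Steps Asc L ∧ P L = u := by
  generalize hk : (Inv n u).card = k
  induction k generalizing u with
  | zero =>
    refine ⟨[], by simp, Steps.nil, ?_⟩
    rw [P_nil, eq_comm]
    apply eq_one hu
    apply BI_of_adj
    intro j h1 h2
    have hj : j < n := by
      by_contra hc; exact h2 (hE j (by omega))
    by_contra hc
    have hne : u (j - 1) ≠ u j := fun h => by
      have := u.injective h; omega
    have := Inv_card' hf h1 hj (by omega)
    omega
  | succ k ih =>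
    by_cases hall : ∀ j, 1 ≤ j → j ∉ E → u (j - 1) < u j
    · have := eq_one hu (BI_of_adj hall)
      rw [this, Inv_one] at hk
      simp at hk
    · push Not at hall
      obtain ⟨j, h1, h2, h3⟩ := hall
      have hj : j < n := by
        by_contra hc; exact h2 (hE j (by omega))
      have hne : u (j - 1) ≠ u j := fun h => by
        have := u.injective h; omega
      have h4 := Inv_card' hf h1 hj (by omega)
      have hS : BP E (S j) := BP.swap (fun m hm => by
        have : m ≠ j := fun h => h2 (h ▸ hm)
        omega)
      obtain ⟨L, e1, e2, e3⟩ := ih (u * S j) (hf.mul (Fx.S hj)) (hu.mul hS) (by omega)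
      refine ⟨L ++ [j], ?_, Steps.snoc _ _ e2 ?_, ?_⟩
      · intro i hi
        simp at hi
        rcases hi with hi | rfl
        · exact e1 i hi
        · exact ⟨h1, hj, h2⟩
      · unfold Asc
        rw [e3]
        simp [S_left, S_right]
        omega
      · rw [P_snoc, e3, mul_assoc, S_mul_self, mul_one]

lemma cnt_le_InvB {E : Set ℕ} {n p q : ℕ} (hpq : Blk E p q) {L : List ℕ}
    (hL : ∀ i ∈ L, 1 ≤ i ∧ i < n ∧ i ∉ E) (h : Steps Asc L) :
    BP E (P L) ∧ cnt p q L ≤ (InvB n p q (P L)).card := by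
  induction h with
  | nil => exact ⟨BP.one E, by simp [cnt]⟩
  | snoc L j h1 h2 ih =>
    have hj := hL j (by simp)
    have hL' : ∀ i ∈ L, 1 ≤ i ∧ i < n ∧ i ∉ E := fun i hi => hL i (by simp [hi])
    obtain ⟨ih1, ih2⟩ := ih hL'
    have hS : BP E (S j) := BP.swap (fun m hm => by
      have : m ≠ j := fun h => hj.2.2 (h ▸ hm)
      omega)
    rw [P_snoc]
    refine ⟨ih1.mul hS, ?_⟩
    have hInv := Inv_step (Fx.P fun i hi => ⟨(hL' i hi).1, (hL' i hi).2.1⟩) hj.1 hj.2.1 h2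
    unfold InvB at ih2 ⊢
    rw [hInv.2, cnt_append, cnt_single, Finset.filter_insert]
    split_ifs with h3 h4 h4
    · rw [Finset.card_insert_of_notMem]
      · omega
      · intro hc
        exact hInv.1 (Finset.mem_filter.1 hc).1
    · exfalso
      apply h4
      simp only
      have h5 := ih1 j q hpq.1
      have h6 : p ≤ P L (j - 1) := by
        rcases hpq.2.1 with h0 | h0
        · omega
        · have := ih1 (j - 1) p h0
          omega
      exact ⟨h6, by omega⟩
    · have := Finset.card_le_card (Finset.subset_insert (P L (j - 1), P L j)
        (Finset.filter (fun z => p ≤ z.1 ∧ z.2 < q) (Inv n (P L))))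
      omega
    · omega

lemma asc_append {E : Set ℕ} {L0 L1 : List ℕ} (h0 : Steps Asc L0) (hb : BP E (P L0))
    (h1 : Steps (Ext E) L1) : Steps Asc (L0 ++ L1) := by
  induction h1 with
  | nil => simpa using h0
  | snoc L j h2 h3 ih =>
    rw [← List.append_assoc]
    refine Steps.snoc _ _ ih ?_
    unfold Asc
    rw [P_append]
    exact hb.lt h3.1 h3.2

/-- extension of a permutation of `Fin n` to ℕ -/
def X (n : ℕ) : Equiv.Perm (Fin n) →* Equiv.Perm ℕ :=
  Equiv.Perm.extendDomainHom (Fin.equivSubtype (n := n))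

lemma X_inj (n : ℕ) : Function.Injective (X n) := Equiv.Perm.extendDomainHom_injective _

lemma X_apply {n : ℕ} (w : Equiv.Perm (Fin n)) (a : Fin n) : X n w a.1 = (w a).1 := by
  have := Equiv.Perm.extendDomain_apply_image w (Fin.equivSubtype (n := n)) a
  exact this

lemma X_fx {n : ℕ} (w : Equiv.Perm (Fin n)) : Fx n (X n w) := fun y hy =>
  Equiv.Perm.extendDomain_apply_not_subtype w (Fin.equivSubtype (n := n)) (by omega)

lemma X_st {n j : ℕ} (h1 : 1 ≤ j) (hj : j < n) : X n (st n j) = S j := by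
  ext y
  by_cases hy : y < n
  · have := X_apply (st n j) ⟨y, hy⟩
    simp only at this
    rw [this, S_apply, st, dif_pos ⟨h1, hj⟩, Equiv.swap_apply_def]
    simp only [Fin.mk.injEq]
    split_ifs <;> rfl
  · rw [X_fx _ y (by omega), Fx.S hj y (by omega)]

lemma X_prod {n : ℕ} {L : List ℕ} (hL : ∀ i ∈ L, 1 ≤ i ∧ i < n) :
    X n (L.map (st n)).prod = P L := by
  induction L with
  | nil => simp [P_nil]
  | cons a L ih =>
    have ha := hL a (by simp)
    rw [List.map_cons, List.prod_cons, map_mul, ih fun i hi => hL i (by simp [hi]),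
      X_st ha.1 ha.2]
    simp [P]

lemma len_eq {n : ℕ} (w : Equiv.Perm (Fin n)) : len n w = (Inv n (X n w)⁻¹).card := by
  unfold len
  refine Finset.card_bij (fun z _ => (z.1.1, z.2.1)) ?_ ?_ ?_
  · rintro ⟨a, b⟩ h
    simp only [Finset.mem_filter, Finset.mem_univ, true_and] at h
    rw [mem_Inv]
    refine ⟨b.2, h.1, ?_⟩
    change X n w b.1 < X n w a.1
    rw [X_apply, X_apply]
    exact h.2
  · rintro ⟨a, b⟩ _ ⟨a', b'⟩ _ h
    simp only [Prod.mk.injEq] at h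
    simp [Fin.ext_iff, h.1, h.2]
  · rintro ⟨a, b⟩ h
    rw [mem_Inv] at h
    refine ⟨(⟨a, by omega⟩, ⟨b, h.1⟩), ?_, rfl⟩
    simp only [Finset.mem_filter, Finset.mem_univ, true_and]
    refine ⟨h.2.1, ?_⟩
    have h2 : X n w b < X n w a := h.2.2
    have h3 := X_apply w ⟨a, by omega⟩
    have h4 := X_apply w ⟨b, h.1⟩
    simp only at h3 h4
    rw [h3, h4] at h2
    exact h2

lemma len_eq' {n : ℕ} (w : Equiv.Perm (Fin n)) : len n w = (Inv n (X n w)).card := by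
  rw [len_eq, Inv_inv (X_fx w)]

lemma len_left {n j : ℕ} (w : Equiv.Perm (Fin n)) (h1 : 1 ≤ j) (hj : j < n)
    (h : len n (st n j * w) ≤ len n w) : (X n w)⁻¹ j < (X n w)⁻¹ (j - 1) := by
  by_contra hc
  have hne : (X n w)⁻¹ (j - 1) ≠ (X n w)⁻¹ j := fun h => by
    have := (X n w)⁻¹.injective h; omega
  have h2 := Inv_card (u := (X n w)⁻¹) (X_fx w).symm h1 hj (by omega)
  rw [len_eq, len_eq, map_mul, X_st h1 hj, mul_inv_rev] at h
  have h3 : (S j)⁻¹ = S j := S_symm j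
  rw [h3] at h
  omega

lemma red_iff {n : ℕ} {L : List ℕ} {w : Equiv.Perm (Fin n)} :
    IsRedWord n L w ↔ (∀ i ∈ L, 1 ≤ i ∧ i < n) ∧ P L = X n w ∧ Steps Asc L := by
  have hr : (∀ i ∈ L, 1 ≤ i ∧ i ≤ n - 1) ↔ (∀ i ∈ L, 1 ≤ i ∧ i < n) :=
    forall₂_congr fun i _ => by omega
  unfold IsRedWord
  rw [hr]
  constructor
  · rintro ⟨h1, h2, h3⟩
    have h4 : P L = X n w := by rw [← X_prod h1, h2]
    refine ⟨h1, h4, (card_asc h1).2 ?_⟩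
    rw [h3, len_eq', h4]
  · rintro ⟨h1, h2, h3⟩
    refine ⟨h1, X_inj n (by rw [X_prod h1, h2]), ?_⟩
    rw [len_eq', ← h2, asc_card h1 h3]

lemma cox_iff {n : ℕ} {w : Equiv.Perm (Fin n)} :
    IsStdCox n w ↔ ∃ L : List ℕ, L.Nodup ∧ (∀ i ∈ L, 1 ≤ i ∧ i < n) ∧ P L = X n w := by
  have hr : ∀ L : List ℕ, (∀ i ∈ L, 1 ≤ i ∧ i ≤ n - 1) ↔ (∀ i ∈ L, 1 ≤ i ∧ i < n) :=
    fun L => forall₂_congr fun i _ => by omega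
  unfold IsStdCox
  refine exists_congr fun L => and_congr_right fun _ => ?_
  rw [hr]
  refine and_congr_right fun h1 => ?_
  rw [← X_prod h1]
  exact ⟨fun h => by rw [h], fun h => X_inj n h⟩

/-- The block boundaries together with all letters outside the range. -/
def EE (n k : ℕ) (d : Fin (k + 2) → ℕ) : Set ℕ := {m | m ∈ Dset k d ∨ n ≤ m}

lemma blk_t {n k : ℕ} {d : Fin (k + 2) → ℕ} (hd : BlockData n k d) (t : Fin (k + 1)) :
    Blk (EE n k d) (d t.castSucc) (d t.succ) := by
  obtain ⟨h0, hl, hm⟩ := hd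
  have hmem : ∀ s : Fin (k + 2), s ≠ 0 → d s ∈ EE n k d := by
    intro s hs
    by_cases h : s = Fin.last (k + 1)
    · right; rw [h, hl]
    · left; exact ⟨s, hs, h, rfl⟩
  refine ⟨hmem _ (Fin.succ_ne_zero t), ?_, ?_⟩
  · by_cases h : t.castSucc = 0
    · left; rw [h, h0]
    · right; exact hmem _ h
  · rintro m (⟨s, _, _, rfl⟩ | h)
    · by_cases h : s ≤ t.castSucc
      · left; exact hm.monotone h
      · right
        apply hm.monotone
        rw [Fin.le_def]
        rw [Fin.le_def] at h
        simp at h ⊢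
        omega
    · right
      have := hm.monotone (Fin.le_last t.succ)
      omega

lemma blk_exists {n k : ℕ} {d : Fin (k + 2) → ℕ} (hd : BlockData n k d) {i : ℕ} (h1 : 1 ≤ i)
    (hi : i ∉ EE n k d) : ∃ t : Fin (k + 1), d t.castSucc < i ∧ i < d t.succ := by
  obtain ⟨h0, hl, hm⟩ := hd
  have hin : i < n := by
    by_contra hc; exact hi (Or.inr (by omega))
  by_contra hc
  push Not at hc
  have key : ∀ s : Fin (k + 2), d s < i := by
    intro s
    induction s using Fin.induction with
    | zero => omega
    | succ t ih =>
      have h2 := hc t ih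
      rcases lt_or_eq_of_le h2 with h3 | h3
      · exact h3
      · exfalso
        apply hi
        left
        refine ⟨t.succ, Fin.succ_ne_zero t, ?_, h3⟩
        intro h
        rw [h, hl] at h3
        omega
  have := key (Fin.last (k + 1))
  omega

/-- Theorem 1.3: equivalence of the two definitions of `I`-spherical.
With `D = [n−1] ∖ I = {d_1 < … < d_k}`, `d_0 = 0`, `d_{k+1} = n`:
`w_0(I)·w` is a standard Coxeter element of a parabolic subgroup iff `w` has a reduced word
satisfying (S.1) and (S.2). -/
theorem stmt0 (n k : ℕ) (d : Fin (k + 2) → ℕ) (hd : BlockData n k d)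
    (w : Equiv.Perm (Fin n)) (I : Set ℕ) (hI : I ⊆ Descents n w)
    (hID : ∀ m, m ∈ I ↔ (1 ≤ m ∧ m ≤ n - 1 ∧ m ∉ Dset k d))
    (w0I : Equiv.Perm (Fin n)) (h0 : IsLongest n I w0I) :
    IsStdCox n (w0I * w) ↔
      ∃ L : List ℕ, IsRedWord n L w ∧
        (∀ m ∈ Dset k d, L.count m ≤ 1) ∧
        ∀ t : Fin (k + 1),
          (L.countP fun m => decide (d t.castSucc < m ∧ m < d t.succ)) <
            Nat.choose (d t.succ - d t.castSucc + 1) 2 := by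
  set E := EE n k d with hE
  have hEn : ∀ m, n ≤ m → m ∈ E := fun m hm => Or.inr hm
  have hIE : ∀ j, j ∈ I ↔ 1 ≤ j ∧ j < n ∧ j ∉ E := by
    intro j
    rw [hID]
    constructor
    · rintro ⟨h1, h2, h3⟩
      refine ⟨h1, by omega, ?_⟩
      rintro (h | h)
      · exact h3 h
      · omega
    · rintro ⟨h1, h2, h3⟩
      exact ⟨h1, by omega, fun h => h3 (Or.inl h)⟩
  have hIE' : ∀ j, 1 ≤ j → j ∉ E → j ∈ I := fun j h1 h2 =>
    (hIE j).2 ⟨h1, by by_contra hc; exact h2 (hEn j (by omega)), h2⟩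
  set U := X n w0I with hU
  set W := X n w with hW
  have hUP : BP E U := by
    have : ∀ v ∈ parab n I, BP E (X n v) := by
      intro v hv
      refine Subgroup.closure_induction ?_ ?_ ?_ ?_ hv
      · rintro _ ⟨j, hj, rfl⟩
        obtain ⟨h1, h2, h3⟩ := (hIE j).1 hj
        rw [X_st h1 h2]
        exact BP.swap fun m hm => by
          have : m ≠ j := fun h => h3 (h ▸ hm)
          omega
      · rw [map_one]; exact BP.one E
      · intro x y _ _ hx hy
        rw [map_mul]; exact hx.mul hy
      · intro x _ hx
        rw [map_inv]; exact hx.inv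
    exact this _ h0.1
  have hUD' : BD E U⁻¹ := by
    apply BD_of_adj
    intro j h1 h2
    have hj := hIE' j h1 h2
    refine len_left w0I h1 ((hIE j).1 hj).2.1 (h0.2 _ ?_)
    exact Subgroup.mul_mem _ (Subgroup.subset_closure ⟨j, hj, rfl⟩) h0.1
  have hUD : BD E U := by
    have := hUD'.inv hUP.inv
    rwa [inv_inv] at this
  have hWD : BD E W⁻¹ := by
    apply BD_of_adj
    intro j h1 h2
    have hj := hIE' j h1 h2
    exact len_left w h1 ((hIE j).1 hj).2.1 (hI hj).2.2.le
  have hdlt : ∀ t : Fin (k + 1), d t.castSucc < d t.succ := fun t =>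
    hd.2.2 Fin.castSucc_lt_succ
  have hdn : ∀ t : Fin (k + 1), d t.succ ≤ n := fun t => by
    have := hd.2.2.monotone (Fin.le_last t.succ)
    rwa [hd.2.1] at this
  have hch : ∀ t : Fin (k + 1), Nat.choose (d t.succ - d t.castSucc + 1) 2 =
      (d t.succ - d t.castSucc) + Nat.choose (d t.succ - d t.castSucc) 2 := fun t => by
    rw [Nat.choose_succ_succ' _ 1, Nat.choose_one_right]
  rw [cox_iff, map_mul]
  constructor
  · rintro ⟨L1, hn, hr, hp⟩
    have hr1 : ∀ i ∈ L1, 1 ≤ i := fun i hi => (hr i hi).1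
    have hext : Steps (Ext E) L1 := by
      apply asc_BI hr1 (nodup_asc hr1 hn)
      rw [hp, mul_inv_rev]
      exact hWD.mul hUD' hUP.inv
    obtain ⟨L0, e1, e2, e3⟩ := exists_word hEn U⁻¹ (X_fx w0I).symm hUP.inv
    refine ⟨L0 ++ L1, red_iff.2 ⟨?_, ?_, ?_⟩, ?_, ?_⟩
    · intro i hi
      rcases List.mem_append.1 hi with h | h
      · exact ⟨(e1 i h).1, (e1 i h).2.1⟩
      · exact hr i h
    · rw [P_append, e3, hp, inv_mul_cancel_left]
    · exact asc_append e2 (e3 ▸ hUP.inv) hext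
    · intro m hm
      rw [List.count_append, List.count_eq_zero.2 (fun h => (e1 m h).2.2 (Or.inl hm)), zero_add]
      exact List.nodup_iff_count_le_one.1 hn m
    · intro t
      change cnt _ _ _ < _
      have hb := blk_t hd t
      have h1 := (cnt_le_InvB hb e1 e2).2
      have h2 := Finset.card_le_card (InvB_sub n (d t.castSucc) (d t.succ) (P L0))
      rw [prs_card] at h2
      have h3 : cnt (d t.castSucc) (d t.succ) L1 ≤ d t.succ - d t.castSucc - 1 := by
        rw [cnt_sum]
        refine (Finset.sum_le_sum (g := fun _ => 1)
          fun i _ => List.nodup_iff_count_le_one.1 hn i).trans ?_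
        simp
      have h4 := hdlt t
      rw [cnt_append, hch]
      omega
  · rintro ⟨L, hred, hD, hcount⟩
    obtain ⟨hr, hp, hasc⟩ := red_iff.1 hred
    have hEc : ∀ m ∈ E, L.count m ≤ 1 := by
      rintro m (h | h)
      · exact hD m h
      · rw [List.count_eq_zero.2]
        · omega
        · intro hm
          have := hr m hm
          omega
    obtain ⟨L', y, f1, f2, f3, f4, f5⟩ := phase1 hr hasc hEc
    have hr' : ∀ i ∈ L', 1 ≤ i ∧ i < n := fun i hi => by
      apply hr i
      rw [← List.one_le_count_iff] at hi ⊢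
      exact hi.trans (f4 i)
    have hr1 : ∀ i ∈ L', 1 ≤ i := fun i hi => (hr' i hi).1
    have hBI := ext_BI hr1 f3
    refine ⟨L', ?_, hr', ?_⟩
    · refine phase2 hr1 f3 (fun m hm => (f4 m).trans (hEc m hm)) ?_
      intro i h1 hi
      obtain ⟨t, ht1, ht2⟩ := blk_exists hd h1 hi
      have hb := blk_t hd t
      refine ⟨_, _, hb, ht1, ht2, ?_⟩
      have h2 := f5 _ _ hb
      have h3 : cnt _ _ _ < _ := hcount t
      rw [InvB_full (hdn t) hb (by rw [hp]; exact hWD), prs_card] at h2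
      rw [hch] at h3
      omega
    · have hyD' : BD E y⁻¹ := by
        intro a b hab hs
        by_contra hc
        have hne : y⁻¹ a ≠ y⁻¹ b := fun h => by
          have := y⁻¹.injective h; omega
        have h1 := hBI (y⁻¹ a) (y⁻¹ b) (by omega)
          (((f2.inv a).trans hs).trans (f2.inv b).symm)
        have h2 := hWD a b hab hs
        rw [hW, ← hp, f1, mul_inv_rev] at h2
        change (P L')⁻¹ (y⁻¹ b) < (P L')⁻¹ (y⁻¹ a) at h2
        omega
      have hyD : BD E y := by
        have := hyD'.inv f2.inv
        rwa [inv_inv] at this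
      have hUy : U * y = 1 := eq_one (hUP.mul f2) (hUD.mul hyD f2)
      rw [← hp, f1, ← mul_assoc, ← hU, hUy, one_mul]

end LSS
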